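/- Let R be a filtered ring, κ a Gabriel filter on R, and M a filtered R-module. If the associated graded module G(M) is κ̄-torsion free, then M is κ-separated; moreover κ(M) = 0. -/

import Mathlib

/-- An exhaustive and separated ascending `ℤ`-filtration `F` on a ring `A`:
`1 ∈ F 0`, `F m * F n ⊆ F (m+n)`, `⋃ F n = A` and `⋂ F n = 0`. -/
structure RingFiltration (A : Type*) [Ring A] where
  F : ℤ → AddSubgroup A
  mono : Monotone F
  one_mem : (1 : A) ∈ F 0
  mul_mem : ∀ {m n : ℤ} {x y : A}, x ∈ F m → y ∈ F n → x * y ∈ F (m + n)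
  exhaustive : ∀ a : A, ∃ n : ℤ, a ∈ F n
  separated : ∀ a : A, (∀ n : ℤ, a ∈ F n) → a = 0
/-- An exhaustive separated ascending `ℤ`-filtration on an `A`-module `M`,
compatible with the ring filtration `FA`. -/
structure ModuleFiltration {A : Type*} [Ring A] (FA : RingFiltration A)
    (M : Type*) [AddCommGroup M] [Module A M] where
  F : ℤ → AddSubgroup M
  mono : Monotone F
  smul_mem : ∀ {m n : ℤ} {a : A} {x : M}, a ∈ FA.F m → x ∈ F n → a • x ∈ F (m + n)
  exhaustive : ∀ x : M, ∃ n : ℤ, x ∈ F n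
  separated : ∀ x : M, (∀ n : ℤ, x ∈ F n) → x = 0
/-- The left ideal `(I : r) = {a | a * r ∈ I}`. -/
def colonIdeal {R : Type*} [Ring R] (I : Ideal R) (r : R) : Ideal R where
  carrier := {a : R | a * r ∈ I}
  add_mem' := fun {a b} ha hb => by
    simpa [add_mul] using I.add_mem ha hb
  zero_mem' := by simp
  smul_mem' := fun c a ha => by
    simpa [smul_eq_mul, mul_assoc] using I.smul_mem c ha

/-- A Gabriel filter of left ideals of `R`. -/
structure GabrielFilter (R : Type*) [Ring R] where
  sets : Set (Ideal R)
  top_mem : ⊤ ∈ sets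
  upward : ∀ {I J : Ideal R}, I ∈ sets → I ≤ J → J ∈ sets
  inter : ∀ {I J : Ideal R}, I ∈ sets → J ∈ sets → I ⊓ J ∈ sets
  colon : ∀ {I : Ideal R}, I ∈ sets → ∀ r : R, colonIdeal I r ∈ sets
  gabriel : ∀ {I J : Ideal R}, I ∈ sets → (∀ x ∈ I, colonIdeal J x ∈ sets) → J ∈ sets

/-- The `κ`-torsion elements of a left `R`-module `M`. -/
def GabrielFilter.torsion {R : Type*} [Ring R] (κ : GabrielFilter R)
    (M : Type*) [AddCommGroup M] [Module R M] : Set M :=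
  {m : M | ∃ I ∈ κ.sets, ∀ i ∈ I, i • m = 0}
/-- `M` is `κ`-separated: if `m ∈ F n M \ F (n-1) M` and some `I ∈ 𝒲(κ)` satisfies
`(I ∩ F γ R) • m ⊆ F (γ+n-1) M` for all `γ` (i.e. `G(I) · σ(m) = 0` in `G(M)`),
then `m ∈ κ(M)`. -/
def KappaSeparated {R : Type*} [Ring R] (κ : GabrielFilter R)
    (FA : RingFiltration R) {M : Type*} [AddCommGroup M] [Module R M]
    (FM : ModuleFiltration FA M) : Prop :=
  ∀ (n : ℤ) (x : M), x ∈ FM.F n → x ∉ FM.F (n - 1) →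
    (∃ I ∈ κ.sets, ∀ γ : ℤ, ∀ i ∈ I, i ∈ FA.F γ → i • x ∈ FM.F (γ + n - 1)) →
    x ∈ κ.torsion M

/-- If `G(M)` is `κ̄`-torsion free (no nonzero homogeneous element
is killed by some `G(I)`, `I ∈ 𝒲(κ)`), then `M` is `κ`-separated and `κ(M) = 0`. -/
theorem stmt13 {R : Type*} [Ring R] (FA : RingFiltration R) (κ : GabrielFilter R)
    {M : Type*} [AddCommGroup M] [Module R M] (FM : ModuleFiltration FA M)
    (htf : ∀ (n : ℤ) (x : M), x ∈ FM.F n →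
      (∃ I ∈ κ.sets, ∀ γ : ℤ, ∀ i ∈ I, i ∈ FA.F γ → i • x ∈ FM.F (γ + n - 1)) →
      x ∈ FM.F (n - 1)) :
    KappaSeparated κ FA FM ∧ ∀ x ∈ κ.torsion M, x = 0 := by
  refine ⟨fun n x hx hx' hI => absurd (htf n x hx hI) hx', ?_⟩
  rintro x ⟨I, hI, hIx⟩
  obtain ⟨n, hn⟩ := FM.exhaustive x
  have descend : ∀ k : ℕ, x ∈ FM.F (n - k) := by
    intro k
    induction k with
    | zero => simpa using hn
    | succ k ih =>
      have h := htf (n - k) x ih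
        ⟨I, hI, fun γ i hi _ => by rw [hIx i hi]; exact zero_mem _⟩
      rwa [Nat.cast_succ, ← sub_sub]
  exact FM.separated x fun m => FM.mono (by lia) (descend (n - m).toNat)
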